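/- Let s ∈ ℝ and let f: ℝⁿ → [0, ∞) be an integrable s-concave function. Then the function p ↦ (p+s)(p+2s)⋯(p+ns) ∫_{ℝⁿ} f(x)^p dx is log-concave for p > max(0, -ns). -/

import Mathlib

open MeasureTheory Real

/-- The `s`-mean of weights `(1-lam, lam)`: for `s ≠ 0` it is
`((1-lam) a^s + lam b^s)^{1/s}`, and for `s = 0` it is `a^{1-lam} b^lam`. -/
noncomputable def sMean (s lam a b : ℝ) : ℝ :=
  if s = 0 then a ^ (1 - lam) * b ^ lam else ((1 - lam) * a ^ s + lam * b ^ s) ^ (1 / s)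

/-- A nonnegative function `f` is `s`-concave if
`f((1-lam)x + lam y) ≥ M_s^{lam}(f(x), f(y))` whenever `f(x) f(y) > 0`. -/
def IsSConcave {E : Type*} [AddCommGroup E] [Module ℝ E] (s : ℝ) (f : E → ℝ) : Prop :=
  ∀ x y, 0 < f x → 0 < f y → ∀ lam ∈ Set.Icc (0 : ℝ) 1,
    sMean s lam (f x) (f y) ≤ f ((1 - lam) • x + lam • y)

open scoped ENNReal

lemma ENNReal.iSup_rpow_mul_iSup_rpow_le {u v : ℕ → ℝ≥0∞} (hu : Monotone u) (hv : Monotone v)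
    {a b : ℝ} (ha : 0 < a) (hb : 0 < b) {w : ℝ≥0∞} (h : ∀ k, u k ^ a * v k ^ b ≤ w) :
    (⨆ k, u k) ^ a * (⨆ k, v k) ^ b ≤ w := by
  have key : ∀ (u : ℕ → ℝ≥0∞) {a : ℝ}, 0 < a → (⨆ k, u k) ^ a = ⨆ k, u k ^ a := fun u a ha ↦
    (ENNReal.orderIsoRpow a ha).map_iSup u
  rw [key u ha, key v hb, ENNReal.iSup_mul]
  refine iSup_le fun i ↦ ?_
  rw [ENNReal.mul_iSup]
  refine iSup_le fun j ↦ le_trans (mul_le_mul' ?_ ?_) (h (max i j))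
  · exact ENNReal.rpow_le_rpow (hu (le_max_left _ _)) ha.le
  · exact ENNReal.rpow_le_rpow (hv (le_max_right _ _)) hb.le

/-- The one-dimensional Brunn–Minkowski inequality. -/
lemma volume_add_volume_le_of_add_mem {A B M : Set ℝ} (hA : MeasurableSet A)
    (hB : MeasurableSet B) (hA' : A.Nonempty) (hB' : B.Nonempty)
    (h : ∀ x ∈ A, ∀ y ∈ B, x + y ∈ M) : volume A + volume B ≤ volume M := by
  have compact_case : ∀ K ⊆ A, IsCompact K → K.Nonempty → ∀ L ⊆ B, IsCompact L → L.Nonempty →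
      volume K + volume L ≤ volume M := by
    intro K hKA hK hK' L hLB hL hL'
    obtain ⟨k, hkK, hk⟩ := hK.exists_isGreatest hK'
    obtain ⟨l, hlL, hl⟩ := hL.exists_isLeast hL'
    have h1 : volume ((fun x ↦ l + x) '' K) = volume K := by
      rw [Set.image_add_left, measure_preimage_add]
    have h2 : volume ((fun x ↦ k + x) '' L) = volume L := by
      rw [Set.image_add_left, measure_preimage_add]
    rw [← h1, ← h2, ← measure_union₀]
    · apply measure_mono
      rintro _ (⟨x, hx, rfl⟩ | ⟨x, hx, rfl⟩)
      · simpa [add_comm] using h x (hKA hx) l (hLB hlL)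
      · exact h k (hKA hkK) x (hLB hx)
    · exact (hL.image (by fun_prop)).measurableSet.nullMeasurableSet
    · refine measure_mono_null (t := {k + l}) ?_ (by simp)
      rintro _ ⟨⟨x, hx, rfl⟩, ⟨y, hy, hxy⟩⟩
      have := hk hx
      have := hl hy
      simp only at hxy ⊢
      rw [Set.mem_singleton_iff]
      linarith
  have approx : ∀ {A : Set ℝ}, MeasurableSet A → A.Nonempty → ∀ c d : ℝ≥0∞,
      (∀ K ⊆ A, IsCompact K → K.Nonempty → volume K + c ≤ d) → volume A + c ≤ d := by
    rintro A hA ⟨x, hx⟩ c d hcd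
    have hc := hcd {x} (by simpa) isCompact_singleton (by simp)
    simp only [volume_singleton, zero_add] at hc
    rcases eq_or_ne c ∞ with rfl | hc'
    · simp [top_le_iff.1 hc]
    rw [← ENNReal.le_sub_iff_add_le_right hc' hc]
    refine le_of_forall_lt fun r hr ↦ ?_
    obtain ⟨K, hKA, hK, hrK⟩ := hA.exists_lt_isCompact hr
    refine hrK.trans_le ?_
    rw [ENNReal.le_sub_iff_add_le_right hc' hc]
    exact hcd K hKA hK (nonempty_of_measure_ne_zero (ne_bot_of_gt hrK))
  refine approx hA hA' _ _ fun K hKA hK hK' ↦ ?_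
  rw [add_comm]
  refine approx hB hB' _ _ fun L hLB hL hL' ↦ ?_
  rw [add_comm]
  exact compact_case K hKA hK hK' L hLB hL hL'

lemma mul_volume_add_mul_volume_le {A B M : Set ℝ} (hA : MeasurableSet A)
    (hB : MeasurableSet B) (hA' : A.Nonempty) (hB' : B.Nonempty) {a b : ℝ} (ha : 0 < a)
    (hb : 0 < b) (h : ∀ x ∈ A, ∀ y ∈ B, a * x + b * y ∈ M) :
    ENNReal.ofReal a * volume A + ENNReal.ofReal b * volume B ≤ volume M := by
  have hvol : ∀ {c : ℝ}, 0 < c → ∀ S : Set ℝ,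
      volume ((fun x ↦ c⁻¹ * x) ⁻¹' S) = ENNReal.ofReal c * volume S := by
    intro c hc S
    rw [Real.volume_preimage_mul_left (inv_ne_zero hc.ne'), inv_inv, abs_of_pos hc]
  rw [← hvol ha, ← hvol hb]
  refine volume_add_volume_le_of_add_mem (hA.preimage (by fun_prop)) (hB.preimage (by fun_prop))
    ?_ ?_ fun x hx y hy ↦ ?_
  · obtain ⟨x, hx⟩ := hA'
    exact ⟨a * x, by simpa [ha.ne'] using hx⟩
  · obtain ⟨x, hx⟩ := hB'
    exact ⟨b * x, by simpa [hb.ne'] using hx⟩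
  · simpa [ha.ne', hb.ne'] using h _ hx _ hy

/-- A layer cake formula for functions bounded by one. -/
lemma lintegral_eq_setLIntegral_Ioo_volume_lt {f : ℝ → ℝ≥0∞} (hf : Measurable f)
    (hf1 : ∀ x, f x ≤ 1) :
    ∫⁻ x, f x = ∫⁻ t in Set.Ioo (0 : ℝ) 1, volume {x | ENNReal.ofReal t < f x} := by
  have hfin : ∀ x, f x ≠ ∞ := fun x ↦ ne_top_of_le_ne_top ENNReal.one_ne_top (hf1 x)
  have h1 : ∫⁻ x, f x = ∫⁻ x, ENNReal.ofReal (f x).toReal := by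
    simp [ENNReal.ofReal_toReal, hfin]
  rw [h1, lintegral_eq_lintegral_meas_lt volume (.of_forall fun x ↦ ENNReal.toReal_nonneg)
    hf.ennreal_toReal.aemeasurable]
  rw [← lintegral_indicator measurableSet_Ioi, ← lintegral_indicator measurableSet_Ioo]
  refine lintegral_congr fun t ↦ ?_
  have hiff : ∀ x, 0 < t → (ENNReal.ofReal t < f x ↔ t < (f x).toReal) := fun x ht ↦
    ENNReal.ofReal_lt_iff_lt_toReal ht.le (hfin x)
  by_cases ht : 0 < t
  · by_cases ht1 : t < 1
    · simp [Set.indicator, ht, ht1, hiff]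
    · have hempty : {x | t < (f x).toReal} = ∅ := by
        ext x
        have : (f x).toReal ≤ 1 := ENNReal.toReal_le_of_le_ofReal zero_le_one (by simpa using hf1 x)
        simp only [Set.mem_ofPred_eq, Set.mem_empty_iff_false, iff_false]
        linarith
      simp [Set.indicator, ht, ht1, hempty]
  · simp [Set.indicator, ht]

lemma ENNReal.geom_mean_le_arith_mean_weighted {a b : ℝ} (ha : 0 < a) (hb : 0 < b)
    (hab : a + b = 1) (x y : ℝ≥0∞) :
    x ^ a * y ^ b ≤ ENNReal.ofReal a * x + ENNReal.ofReal b * y := by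
  rcases eq_or_ne x ∞ with rfl | hx
  · simp [ENNReal.mul_top, ha]
  rcases eq_or_ne y ∞ with rfl | hy
  · simp [ENNReal.mul_top, hb]
  lift x to NNReal using hx
  lift y to NNReal using hy
  lift a to NNReal using ha.le
  lift b to NNReal using hb.le
  rw [← ENNReal.coe_rpow_of_nonneg _ a.coe_nonneg, ← ENNReal.coe_rpow_of_nonneg _ b.coe_nonneg,
    ENNReal.ofReal_coe_nnreal, ENNReal.ofReal_coe_nnreal]
  exact_mod_cast NNReal.geom_mean_le_arith_mean2_weighted a b x y (by exact_mod_cast hab)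

lemma prekopaLeindler_real_of_iSup_eq_one {f g h : ℝ → ℝ≥0∞} (hf : Measurable f)
    (hg : Measurable g) (hh : Measurable h) (hf1 : ⨆ x, f x = 1) (hg1 : ⨆ x, g x = 1)
    {a b : ℝ} (ha : 0 < a) (hb : 0 < b) (hab : a + b = 1)
    (hfgh : ∀ x y, f x ^ a * g y ^ b ≤ h (a * x + b * y)) :
    (∫⁻ x, f x) ^ a * (∫⁻ x, g x) ^ b ≤ ∫⁻ x, h x := by
  refine (ENNReal.geom_mean_le_arith_mean_weighted ha hb hab _ _).trans ?_
  have hmono : ∀ u : ℝ → ℝ≥0∞, Measurable fun t : ℝ ↦ volume {x | ENNReal.ofReal t < u x} :=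
    fun u ↦ Antitone.measurable fun s t hst ↦ measure_mono fun x hx ↦
      (ENNReal.ofReal_le_ofReal hst).trans_lt hx
  calc (ENNReal.ofReal a * ∫⁻ x, f x) + ENNReal.ofReal b * ∫⁻ x, g x
      = ∫⁻ t in Set.Ioo (0 : ℝ) 1, (ENNReal.ofReal a * volume {x | ENNReal.ofReal t < f x}
          + ENNReal.ofReal b * volume {x | ENNReal.ofReal t < g x}) := by
        rw [lintegral_eq_setLIntegral_Ioo_volume_lt hf fun x ↦ hf1 ▸ le_iSup f x,
          lintegral_eq_setLIntegral_Ioo_volume_lt hg fun x ↦ hg1 ▸ le_iSup g x,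
          lintegral_add_left ((hmono f).const_mul _), lintegral_const_mul _ (hmono f),
          lintegral_const_mul _ (hmono g)]
    _ ≤ ∫⁻ t in Set.Ioo (0 : ℝ) 1, volume {x | ENNReal.ofReal t < min (h x) 1} := by
        refine setLIntegral_mono' measurableSet_Ioo fun t ht ↦ ?_
        have ht1 : ENNReal.ofReal t < 1 := by simpa using ht.2
        refine mul_volume_add_mul_volume_le (measurableSet_lt measurable_const hf)
          (measurableSet_lt measurable_const hg) ?_ ?_ ha hb fun x hx y hy ↦ ?_
        · exact lt_iSup_iff.1 (hf1 ▸ ht1)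
        · exact lt_iSup_iff.1 (hg1 ▸ ht1)
        · refine lt_min (lt_of_lt_of_le ?_ (hfgh x y)) ht1
          calc ENNReal.ofReal t = ENNReal.ofReal t ^ a * ENNReal.ofReal t ^ b := by
                rw [← ENNReal.rpow_add _ _ (by simpa using ht.1) (by simp), hab, ENNReal.rpow_one]
            _ < f x ^ a * g y ^ b :=
                ENNReal.mul_lt_mul (ENNReal.rpow_lt_rpow hx ha) (ENNReal.rpow_lt_rpow hy hb)
    _ = ∫⁻ x, min (h x) 1 := by
        rw [lintegral_eq_setLIntegral_Ioo_volume_lt (hh.min measurable_const)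
          fun x ↦ min_le_right _ _]
    _ ≤ ∫⁻ x, h x := lintegral_mono fun x ↦ min_le_left _ _

/-- The Prékopa–Leindler inequality for a measure. -/
def PrekopaLeindler {E : Type*} [AddCommGroup E] [Module ℝ E] [MeasurableSpace E]
    (μ : Measure E) : Prop :=
  ∀ ⦃a b : ℝ⦄, 0 < a → 0 < b → a + b = 1 → ∀ ⦃f g h : E → ℝ≥0∞⦄, Measurable f → Measurable g →
    Measurable h → (∀ x y, f x ^ a * g y ^ b ≤ h (a • x + b • y)) →
    (∫⁻ x, f x ∂μ) ^ a * (∫⁻ x, g x ∂μ) ^ b ≤ ∫⁻ x, h x ∂μ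

lemma prekopaLeindler_real_of_bounded {f g h : ℝ → ℝ≥0∞} (hf : Measurable f)
    (hg : Measurable g) (hh : Measurable h) (hf1 : ⨆ x, f x ≠ ∞) (hg1 : ⨆ x, g x ≠ ∞)
    {a b : ℝ} (ha : 0 < a) (hb : 0 < b) (hab : a + b = 1)
    (hfgh : ∀ x y, f x ^ a * g y ^ b ≤ h (a * x + b * y)) :
    (∫⁻ x, f x) ^ a * (∫⁻ x, g x) ^ b ≤ ∫⁻ x, h x := by
  set F := ⨆ x, f x with hF
  set G := ⨆ x, g x with hG
  rcases eq_or_ne F 0 with hF0 | hF0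
  · have : ∀ x, f x = 0 := fun x ↦ le_antisymm (hF0 ▸ le_iSup f x) zero_le
    simp [this, ha]
  rcases eq_or_ne G 0 with hG0 | hG0
  · have : ∀ x, g x = 0 := fun x ↦ le_antisymm (hG0 ▸ le_iSup g x) zero_le
    simp [this, hb]
  have hc0 : F ^ a * G ^ b ≠ 0 :=
    mul_ne_zero (by simp [hF0, hf1]) (by simp [hG0, hg1])
  have hc1 : F ^ a * G ^ b ≠ ∞ := ENNReal.mul_ne_top
    (ENNReal.rpow_ne_top_of_nonneg ha.le hf1) (ENNReal.rpow_ne_top_of_nonneg hb.le hg1)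
  have hinv : (F ^ a * G ^ b)⁻¹ = F⁻¹ ^ a * G⁻¹ ^ b := by
    rw [ENNReal.mul_inv (.inr (ENNReal.rpow_ne_top_of_nonneg hb.le hg1))
      (.inl (ENNReal.rpow_ne_top_of_nonneg ha.le hf1)), ENNReal.inv_rpow, ENNReal.inv_rpow]
  have key := prekopaLeindler_real_of_iSup_eq_one (hf.const_mul F⁻¹) (hg.const_mul G⁻¹)
    (hh.const_mul (F ^ a * G ^ b)⁻¹) (by rw [← ENNReal.mul_iSup, ENNReal.inv_mul_cancel hF0 hf1])
    (by rw [← ENNReal.mul_iSup, ENNReal.inv_mul_cancel hG0 hg1]) ha hb hab fun x y ↦ by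
      rw [ENNReal.mul_rpow_of_nonneg _ _ ha.le, ENNReal.mul_rpow_of_nonneg _ _ hb.le,
        mul_mul_mul_comm, hinv]
      exact mul_le_mul_right (hfgh x y) _
  rw [lintegral_const_mul _ hf, lintegral_const_mul _ hg, lintegral_const_mul _ hh,
    ENNReal.mul_rpow_of_nonneg _ _ ha.le, ENNReal.mul_rpow_of_nonneg _ _ hb.le,
    mul_mul_mul_comm, ← hinv] at key
  exact (ENNReal.mul_le_mul_iff_right (by simpa using hc1) (by simpa using hc0)).1 key

lemma ENNReal.iSup_min_natCast (x : ℝ≥0∞) : ⨆ k : ℕ, min x k = x := by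
  rw [← inf_iSup_eq, ENNReal.iSup_natCast, inf_top_eq]

lemma prekopaLeindler_real : PrekopaLeindler (volume : Measure ℝ) := by
  intro a b ha hb hab f g h hf hg hh hfgh
  have hsup : ∀ u : ℝ → ℝ≥0∞, Measurable u → ∫⁻ x, u x = ⨆ k : ℕ, ∫⁻ x, min (u x) k := by
    intro u hu
    rw [← lintegral_iSup (fun k ↦ hu.min measurable_const)
      fun i j hij x ↦ min_le_min_left _ (by exact_mod_cast hij)]
    simp only [ENNReal.iSup_min_natCast]
  have hmono : ∀ u : ℝ → ℝ≥0∞, Monotone fun k : ℕ ↦ ∫⁻ x, min (u x) k :=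
    fun u i j hij ↦ lintegral_mono fun x ↦ min_le_min_left _ (by exact_mod_cast hij)
  rw [hsup f hf, hsup g hg]
  refine ENNReal.iSup_rpow_mul_iSup_rpow_le (hmono f) (hmono g) ha hb fun k ↦ ?_
  have hbdd : ∀ u : ℝ → ℝ≥0∞, ⨆ x, min (u x) (k : ℝ≥0∞) ≠ ∞ := fun u ↦
    ne_top_of_le_ne_top (ENNReal.natCast_ne_top k) (iSup_le fun x ↦ min_le_right _ _)
  refine prekopaLeindler_real_of_bounded (hf.min measurable_const) (hg.min measurable_const) hh
    (hbdd f) (hbdd g) ha hb hab fun x y ↦ le_trans ?_ (hfgh x y)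
  gcongr <;> exact min_le_left _ _

lemma PrekopaLeindler.prod {E F : Type*} [AddCommGroup E] [Module ℝ E] [MeasurableSpace E]
    [AddCommGroup F] [Module ℝ F] [MeasurableSpace F] {μ : Measure E} {ν : Measure F} [SFinite ν]
    (hμ : PrekopaLeindler μ) (hν : PrekopaLeindler ν) : PrekopaLeindler (μ.prod ν) := by
  intro a b ha hb hab f g h hf hg hh hfgh
  rw [lintegral_prod _ hf.aemeasurable, lintegral_prod _ hg.aemeasurable,
    lintegral_prod _ hh.aemeasurable]
  refine hμ ha hb hab hf.lintegral_prod_right' hg.lintegral_prod_right' hh.lintegral_prod_right'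
    fun x y ↦ ?_
  exact hν ha hb hab (hf.comp measurable_prodMk_left) (hg.comp measurable_prodMk_left)
    (hh.comp measurable_prodMk_left) fun u v ↦ hfgh (x, u) (y, v)

lemma prekopaLeindler_pi (n : ℕ) : PrekopaLeindler (volume : Measure (Fin n → ℝ)) := by
  induction n with
  | zero =>
    intro a b ha hb hab f g h hf hg hh hfgh
    have hvol : (volume : Measure (Fin 0 → ℝ)) = Measure.dirac 0 := by
      rw [volume_pi, Measure.pi_of_empty (x := 0)]
    simp only [hvol, lintegral_dirac]
    convert hfgh 0 0
  | succ n ih =>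
    intro a b ha hb hab f g h hf hg hh hfgh
    let e := MeasurableEquiv.piFinSuccAbove (fun _ : Fin (n + 1) ↦ ℝ) 0
    have he : MeasurePreserving e.symm :=
      (volume_preserving_piFinSuccAbove (fun _ : Fin (n + 1) ↦ ℝ) 0).symm
    rw [← he.lintegral_comp hf, ← he.lintegral_comp hg, ← he.lintegral_comp hh]
    refine prekopaLeindler_real.prod ih ha hb hab (hf.comp e.symm.measurable)
      (hg.comp e.symm.measurable) (hh.comp e.symm.measurable) fun x y ↦ ?_
    convert hfgh (e.symm x) (e.symm y) using 2
    ext i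
    refine Fin.cases ?_ (fun i ↦ ?_) i <;> simp [e, MeasurableEquiv.piFinSuccAbove]

lemma exists_affine_le_rpow_iff_mem {θ : ℝ} (hθ0 : 0 < θ) (hθ1 : θ < 1) {S : Set ℝ}
    (hS : S.OrdConnected) (hpos : S ⊆ Set.Ioi 0) :
    ∃ c₀ c₁ : ℝ, (∀ u ∈ S, c₀ + c₁ * u ≤ u ^ θ) ∧ ∀ u, 0 < u → u ∉ S → u ^ θ ≤ c₀ + c₁ * u := by
  have tangent : ∀ v : ℝ, 0 < v → S ⊆ {v} → ∃ c₀ c₁ : ℝ,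
      (∀ u ∈ S, c₀ + c₁ * u ≤ u ^ θ) ∧ ∀ u, 0 < u → u ∉ S → u ^ θ ≤ c₀ + c₁ * u := by
    intro v hv hSv
    refine ⟨v ^ θ * (1 - θ), v ^ θ * θ / v, fun u hu ↦ ?_, fun u hu _ ↦ ?_⟩
    · rw [hSv hu]
      apply le_of_eq
      field_simp
      ring
    · have := Real.geom_mean_le_arith_mean2_weighted hθ0.le (sub_nonneg.2 hθ1.le)
        (div_pos hu hv).le zero_le_one (by ring)
      rw [Real.one_rpow, mul_one, Real.div_rpow hu.le hv.le,
        div_le_iff₀ (Real.rpow_pos_of_pos hv _)] at this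
      refine this.trans_eq ?_
      field_simp
      ring
  rcases S.eq_empty_or_nonempty with rfl | hne
  · exact tangent 1 one_pos (Set.empty_subset _)
  have hbelow : BddBelow S := ⟨0, fun x hx ↦ (hpos hx).le⟩
  have hmem : ∀ u, sInf S < u → (∃ v ∈ S, u < v) → u ∈ S := by
    rintro u hu ⟨v, hv, huv⟩
    obtain ⟨w, hw, hwu⟩ := exists_lt_of_csInf_lt hne hu
    exact hS.out hw hv ⟨hwu.le, huv.le⟩
  have hα : 0 ≤ sInf S := le_csInf hne fun x hx ↦ (hpos hx).le
  set α := sInf S with hαdef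
  by_cases habove : BddAbove S
  · set β := sSup S with hβdef
    have hαβ : α ≤ β := csInf_le_csSup hne hbelow habove
    rcases hαβ.eq_or_lt with heq | hlt
    · obtain ⟨v, hv⟩ := hne
      refine tangent v (hpos hv) fun u hu ↦ ?_
      have h1 := csInf_le hbelow hu
      have h2 := csInf_le hbelow hv
      have h3 := le_csSup habove hu
      have h4 := le_csSup habove hv
      exact Set.mem_singleton_iff.2 (by linarith)
    · have hconc := Real.concaveOn_rpow hθ0.le hθ1.le
      set φ : ℝ → ℝ := fun x ↦ x ^ θ with hφ
      have hβα : 0 < β - α := sub_pos.2 hlt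
      have hβ : β ∈ Set.Ici (0 : ℝ) := hα.trans hαβ
      set m := (φ β - φ α) / (β - α) with hm
      have hmβ : m * (β - α) = φ β - φ α := div_mul_cancel₀ _ hβα.ne'
      refine ⟨φ α - m * α, m, fun u hu ↦ ?_, fun u hu huS ↦ ?_⟩
      · change _ ≤ φ u
        have h1 : α ≤ u := csInf_le hbelow hu
        have h2 : u ≤ β := le_csSup habove hu
        rcases h1.eq_or_lt with rfl | h1
        · linarith
        rcases h2.eq_or_lt with rfl | h2
        · linarith
        have := hconc.slope_anti_adjacent hα hβ h1 h2
        rw [div_le_div_iff₀ (sub_pos.2 h2) (sub_pos.2 h1)] at this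
        refine le_of_mul_le_mul_right ?_ hβα
        linear_combination this + (u - α) * hmβ
      · change φ u ≤ _
        rcases lt_trichotomy u α with h1 | rfl | h1
        · have := hconc.slope_anti_adjacent (Set.mem_Ici.2 hu.le) hβ h1 hlt
          rw [le_div_iff₀ (sub_pos.2 h1)] at this
          linarith
        · linarith
        rcases lt_trichotomy u β with h2 | h2 | h2
        · exact absurd (hmem u h1 (exists_lt_of_lt_csSup hne h2)) huS
        · rw [h2]; linarith
        · have := hconc.slope_anti_adjacent hα (Set.mem_Ici.2 hu.le) hlt h2
          rw [div_le_iff₀ (sub_pos.2 h2)] at this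
          linarith
  · refine ⟨α ^ θ, 0, fun u hu ↦ ?_, fun u hu huS ↦ ?_⟩
    · simpa using Real.rpow_le_rpow hα (csInf_le hbelow hu) hθ0.le
    · rw [zero_mul, add_zero]
      refine Real.rpow_le_rpow hu.le (not_lt.1 fun h ↦ huS (hmem u h ?_)) hθ0.le
      exact not_bddAbove_iff.1 habove u

lemma integrableOn_rpow_mul_exp_neg_mul_Ioi {q r : ℝ} (hq : 0 < q) (hr : 0 < r) :
    IntegrableOn (fun t : ℝ ↦ t ^ (q - 1) * exp (-(r * t))) (Set.Ioi 0) := by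
  refine Integrable.of_integral_ne_zero ?_
  rw [Real.integral_rpow_mul_exp_neg_mul_Ioi hq hr]
  have := Real.Gamma_pos_of_pos hq
  positivity

lemma gamma_normalized_moment_le_of_lt {H : ℝ → ℝ}
    (hlog : ∀ t₀ t₁ : ℝ, 0 < t₀ → 0 < t₁ → ∀ a b : ℝ, 0 < a → 0 < b → a + b = 1 →
      H t₀ ^ a * H t₁ ^ b ≤ H (a * t₀ + b * t₁))
    (hinteg : ∀ q : ℝ, 0 < q → IntegrableOn (fun t ↦ t ^ (q - 1) * H t) (Set.Ioi 0))
    {q₀ q₁ : ℝ} (hq₀ : 0 < q₀) (hq : q₀ < q₁)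
    (hm₀ : 0 < ∫ t in Set.Ioi 0, t ^ (q₀ - 1) * H t)
    (hm₁ : 0 < ∫ t in Set.Ioi 0, t ^ (q₁ - 1) * H t)
    {a b : ℝ} (ha : 0 < a) (hb : 0 < b) (hab : a + b = 1) :
    ((∫ t in Set.Ioi 0, t ^ (q₀ - 1) * H t) / Gamma q₀) ^ a *
      ((∫ t in Set.Ioi 0, t ^ (q₁ - 1) * H t) / Gamma q₁) ^ b ≤
      (∫ t in Set.Ioi 0, t ^ (a * q₀ + b * q₁ - 1) * H t) / Gamma (a * q₀ + b * q₁) := by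
  have hq₁ : 0 < q₁ := hq₀.trans hq
  have hd : 0 < q₁ - q₀ := sub_pos.2 hq
  obtain ⟨q, hqdef⟩ : ∃ q, q = a * q₀ + b * q₁ := ⟨_, rfl⟩
  have hqpos : 0 < q := by rw [hqdef]; positivity
  rw [← hqdef]
  set m : ℝ → ℝ := fun q ↦ ∫ t in Set.Ioi 0, t ^ (q - 1) * H t with hm
  change 0 < m q₀ at hm₀
  change 0 < m q₁ at hm₁
  change (m q₀ / Gamma q₀) ^ a * (m q₁ / Gamma q₁) ^ b ≤ m q / Gamma q
  have hG₀ := Real.Gamma_pos_of_pos hq₀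
  have hG₁ := Real.Gamma_pos_of_pos hq₁
  have hG := Real.Gamma_pos_of_pos hqpos
  -- the exponential density having the same moments of orders `q₀` and `q₁`
  obtain ⟨A, B, hA, hB, hAB₀, hAB₁⟩ : ∃ A B : ℝ, 0 < A ∧ 0 < B ∧
      m q₀ / Gamma q₀ = A * B ^ (-q₀) ∧ m q₁ / Gamma q₁ = A * B ^ (-q₁) := by
    have h₀ : 0 < m q₀ / Gamma q₀ := div_pos hm₀ hG₀
    have h₁ : 0 < m q₁ / Gamma q₁ := div_pos hm₁ hG₁
    set M₀ := m q₀ / Gamma q₀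
    set M₁ := m q₁ / Gamma q₁
    have hB : 0 < (M₀ / M₁) ^ (1 / (q₁ - q₀)) := by positivity
    refine ⟨M₀ * ((M₀ / M₁) ^ (1 / (q₁ - q₀))) ^ q₀, (M₀ / M₁) ^ (1 / (q₁ - q₀)),
      by positivity, hB, ?_, ?_⟩
    · rw [mul_assoc, ← Real.rpow_add hB]
      simp
    · rw [mul_assoc, ← Real.rpow_add hB, ← Real.rpow_mul (by positivity)]
      have : 1 / (q₁ - q₀) * (q₀ + -q₁) = -1 := by field_simp; ring
      rw [this, Real.rpow_neg_one]
      field_simp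
  let D : ℝ → ℝ := fun t ↦ H t - A * exp (-(B * t))
  have hexp : ∀ {q : ℝ}, 0 < q → ∫ t in Set.Ioi (0 : ℝ), t ^ (q - 1) * (A * exp (-(B * t))) =
      A * B ^ (-q) * Gamma q := by
    intro q hq
    simp_rw [mul_left_comm _ A]
    rw [integral_const_mul, Real.integral_rpow_mul_exp_neg_mul_Ioi hq hB, one_div,
      Real.inv_rpow hB.le, ← Real.rpow_neg hB.le, mul_assoc]
  have hexpint : ∀ {q : ℝ}, 0 < q →
      IntegrableOn (fun t ↦ t ^ (q - 1) * (A * exp (-(B * t)))) (Set.Ioi 0) := by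
    intro q hq
    simp_rw [mul_left_comm _ A]
    exact (integrableOn_rpow_mul_exp_neg_mul_Ioi hq hB).const_mul A
  have hDint : ∀ {q : ℝ}, 0 < q → IntegrableOn (fun t ↦ t ^ (q - 1) * D t) (Set.Ioi 0) := by
    intro q hq
    simp only [D, mul_sub]
    exact (hinteg q hq).sub (hexpint hq)
  have hDm : ∀ {q : ℝ}, 0 < q →
      ∫ t in Set.Ioi (0 : ℝ), t ^ (q - 1) * D t = m q - A * B ^ (-q) * Gamma q := by
    intro q hq
    simp only [D, mul_sub]
    rw [integral_sub (hinteg q hq) (hexpint hq), hexp hq]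
  have hD₀ : ∫ t in Set.Ioi (0 : ℝ), t ^ (q₀ - 1) * D t = 0 := by
    rw [hDm hq₀, ← hAB₀]; field_simp; ring
  have hD₁ : ∫ t in Set.Ioi (0 : ℝ), t ^ (q₁ - 1) * D t = 0 := by
    rw [hDm hq₁, ← hAB₁]; field_simp; ring
  let S : Set ℝ := {u | 0 < u ∧ 0 < D (u ^ (1 / (q₁ - q₀)))}
  have hDconn : ∀ x y z, 0 < x → x < y → y < z → 0 < D x → 0 < D z → 0 < D y := by
    intro x y z hx hxy hyz hDx hDz
    have hz : 0 < z - x := by linarith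
    have h1 : 0 < (z - y) / (z - x) := div_pos (by linarith) hz
    have h2 : 0 < (y - x) / (z - x) := div_pos (by linarith) hz
    have h3 : (z - y) / (z - x) + (y - x) / (z - x) = 1 := by field_simp; ring
    have h4 : (z - y) / (z - x) * x + (y - x) / (z - x) * z = y := by field_simp; ring
    set w₁ := (z - y) / (z - x)
    set w₂ := (y - x) / (z - x)
    have h5 := hlog x z hx (hx.trans (hxy.trans hyz)) _ _ h1 h2 h3
    rw [h4] at h5
    refine sub_pos.2 (lt_of_lt_of_le ?_ h5)
    calc A * exp (-(B * y))
        = (A * exp (-(B * x))) ^ w₁ * (A * exp (-(B * z))) ^ w₂ := by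
          rw [Real.mul_rpow hA.le (exp_pos _).le, Real.mul_rpow hA.le (exp_pos _).le,
            mul_mul_mul_comm, ← Real.rpow_add hA, h3, Real.rpow_one, ← Real.exp_mul,
            ← Real.exp_mul, ← Real.exp_add]
          congr 2
          rw [← h4]; ring
      _ < H x ^ w₁ * H z ^ w₂ := by
          have e1 := Real.rpow_lt_rpow (by positivity) (sub_pos.1 hDx) h1
          have e2 := Real.rpow_lt_rpow (by positivity) (sub_pos.1 hDz) h2
          exact mul_lt_mul'' e1 e2 (by positivity) (by positivity)
  have hS : S.OrdConnected := by
    refine ⟨fun x hx z hz y hy ↦ ?_⟩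
    have hy0 : 0 < y := hx.1.trans_le hy.1
    refine ⟨hy0, ?_⟩
    rcases hy.1.eq_or_lt with rfl | hxy
    · exact hx.2
    rcases hy.2.eq_or_lt with rfl | hyz
    · exact hz.2
    have he : 0 < 1 / (q₁ - q₀) := one_div_pos.2 hd
    exact hDconn _ _ _ (Real.rpow_pos_of_pos hx.1 _) (Real.rpow_lt_rpow hx.1.le hxy he)
      (Real.rpow_lt_rpow hy0.le hyz he) hx.2 hz.2
  obtain ⟨c₀, c₁, hin, hout⟩ := exists_affine_le_rpow_iff_mem hb (by linarith) hS fun u hu ↦ hu.1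
  have hkey : 0 ≤ ∫ t in Set.Ioi (0 : ℝ),
      (t ^ (q - 1) * D t - c₀ * (t ^ (q₀ - 1) * D t) - c₁ * (t ^ (q₁ - 1) * D t)) := by
    refine setIntegral_nonneg measurableSet_Ioi fun t (ht : 0 < t) ↦ ?_
    have hu : 0 < t ^ (q₁ - q₀) := Real.rpow_pos_of_pos ht _
    have hinv : (t ^ (q₁ - q₀)) ^ (1 / (q₁ - q₀)) = t := by
      rw [← Real.rpow_mul ht.le, mul_one_div_cancel hd.ne', Real.rpow_one]
    have hexpq : t ^ (q - 1) = t ^ (q₀ - 1) * (t ^ (q₁ - q₀)) ^ b := by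
      rw [← Real.rpow_mul ht.le, ← Real.rpow_add ht]
      congr 1
      rw [hqdef]; linear_combination q₀ * hab
    have hexp₁ : t ^ (q₁ - 1) = t ^ (q₀ - 1) * t ^ (q₁ - q₀) := by
      rw [← Real.rpow_add ht]
      congr 1
      ring
    rw [hexpq, hexp₁]
    have hfac : ∀ x y : ℝ, x * y ^ b * D t - c₀ * (x * D t) - c₁ * (x * y * D t) =
        x * ((y ^ b - (c₀ + c₁ * y)) * D t) := fun x y ↦ by ring
    rw [hfac]
    refine mul_nonneg (Real.rpow_nonneg ht.le _) ?_
    by_cases hDt : 0 < D t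
    · exact mul_nonneg (sub_nonneg.2 (hin _ ⟨hu, by rwa [hinv]⟩)) hDt.le
    · refine mul_nonneg_of_nonpos_of_nonpos (sub_nonpos.2 (hout _ hu fun h ↦ hDt ?_)) (not_lt.1 hDt)
      rw [← hinv]
      exact h.2
  rw [integral_sub, integral_sub, integral_const_mul, integral_const_mul, hD₀, hD₁, hDm hqpos]
    at hkey
  rotate_left
  · exact hDint hqpos
  · exact (hDint hq₀).const_mul _
  · exact (hDint hqpos).sub ((hDint hq₀).const_mul _)
  · exact (hDint hq₁).const_mul _
  rw [hAB₀, hAB₁, le_div_iff₀ hG, Real.mul_rpow hA.le (by positivity),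
    Real.mul_rpow hA.le (by positivity), mul_mul_mul_comm, ← Real.rpow_add hA, hab, Real.rpow_one,
    ← Real.rpow_mul hB.le, ← Real.rpow_mul hB.le, ← Real.rpow_add hB]
  have : -q₀ * a + -q₁ * b = -q := by rw [hqdef]; ring
  rw [this]
  linarith

/-- Log-concavity of an extended nonnegative function on a set. -/
def ENNLogConcaveOn {E : Type*} [AddCommGroup E] [Module ℝ E] (s : Set E) (F : E → ℝ≥0∞) : Prop :=
  ∀ x ∈ s, ∀ y ∈ s, ∀ a b : ℝ, 0 < a → 0 < b → a + b = 1 → F x ^ a * F y ^ b ≤ F (a • x + b • y)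

lemma setLIntegral_rpow_mul_eq_ofReal_integral {H : ℝ → ℝ≥0∞} (hH : Measurable H) {k : ℕ}
    (hk : ∀ t, H t ≤ k) (hk0 : ∀ t : ℝ, k < t → H t = 0) {q : ℝ} (hq : 0 < q) :
    IntegrableOn (fun t : ℝ ↦ t ^ (q - 1) * (H t).toReal) (Set.Ioi 0) ∧
    ∫⁻ t in Set.Ioi (0 : ℝ), ENNReal.ofReal (t ^ (q - 1)) * H t =
      ENNReal.ofReal (∫ t in Set.Ioi (0 : ℝ), t ^ (q - 1) * (H t).toReal) := by
  have hfin : ∀ t, H t ≠ ∞ := fun t ↦ ne_top_of_le_ne_top (ENNReal.natCast_ne_top k) (hk t)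
  have hinteg : IntegrableOn (fun t : ℝ ↦ t ^ (q - 1) * (H t).toReal) (Set.Ioi 0) := by
    have h1 : IntegrableOn (fun t : ℝ ↦ t ^ (q - 1) * k) (Set.Ioc 0 k) :=
      (intervalIntegral.intervalIntegrable_rpow' (a := 0) (b := k) (by linarith)).1.mul_const _
    rw [← integrable_indicator_iff measurableSet_Ioc] at h1
    refine Integrable.mono' h1.integrableOn (by fun_prop) ?_
    refine (ae_restrict_iff' measurableSet_Ioi).2 (.of_forall fun t (ht : 0 < t) ↦ ?_)
    by_cases htk : t ≤ k
    · rw [Set.indicator_of_mem (show t ∈ Set.Ioc (0 : ℝ) k from ⟨ht, htk⟩), Real.norm_of_nonneg (by positivity)]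
      gcongr
      exact ENNReal.toReal_le_of_le_ofReal (by positivity) (by simpa using hk t)
    · rw [Set.indicator_of_notMem (fun h : t ∈ Set.Ioc (0 : ℝ) k ↦ htk h.2), hk0 t (not_le.1 htk)]
      simp
  refine ⟨hinteg, ?_⟩
  rw [ofReal_integral_eq_lintegral_ofReal hinteg]
  · refine setLIntegral_congr_fun measurableSet_Ioi fun t (ht : 0 < t) ↦ ?_
    rw [ENNReal.ofReal_mul (by positivity), ENNReal.ofReal_toReal (hfin t)]
  · refine (ae_restrict_iff' measurableSet_Ioi).2 (.of_forall fun t (ht : 0 < t) ↦ ?_)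
    simp only [Pi.zero_apply]
    positivity

lemma ENNLogConcaveOn.gamma_normalized_moment_of_bounded {H : ℝ → ℝ≥0∞} (hH : Measurable H)
    (hlog : ENNLogConcaveOn (Set.Ioi 0) H) {k : ℕ} (hk : ∀ t, H t ≤ k)
    (hk0 : ∀ t : ℝ, k < t → H t = 0) :
    ENNLogConcaveOn (Set.Ioi 0) fun q ↦ (ENNReal.ofReal (Gamma q))⁻¹ *
      ∫⁻ t in Set.Ioi (0 : ℝ), ENNReal.ofReal (t ^ (q - 1)) * H t := by
  have hfin : ∀ t, H t ≠ ∞ := fun t ↦ ne_top_of_le_ne_top (ENNReal.natCast_ne_top k) (hk t)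
  have hlog' : ∀ t₀ t₁ : ℝ, 0 < t₀ → 0 < t₁ → ∀ a b : ℝ, 0 < a → 0 < b → a + b = 1 →
      (H t₀).toReal ^ a * (H t₁).toReal ^ b ≤ (H (a * t₀ + b * t₁)).toReal := by
    intro t₀ t₁ h₀ h₁ a b ha hb hab
    rw [ENNReal.toReal_rpow, ENNReal.toReal_rpow, ← ENNReal.toReal_mul]
    exact ENNReal.toReal_mono (hfin _) (hlog t₀ h₀ t₁ h₁ a b ha hb hab)
  set m : ℝ → ℝ := fun q ↦ ∫ t in Set.Ioi (0 : ℝ), t ^ (q - 1) * (H t).toReal with hm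
  set F : ℝ → ℝ≥0∞ := fun q ↦ (ENNReal.ofReal (Gamma q))⁻¹ *
      ∫⁻ t in Set.Ioi (0 : ℝ), ENNReal.ofReal (t ^ (q - 1)) * H t with hFdef
  have hF : ∀ q : ℝ, 0 < q → F q = ENNReal.ofReal (m q / Gamma q) := by
    intro q hq
    rw [hFdef, ENNReal.ofReal_div_of_pos (Gamma_pos_of_pos hq), ENNReal.div_eq_inv_mul]
    simp only
    rw [(setLIntegral_rpow_mul_eq_ofReal_integral hH hk hk0 hq).2]
  have hm0 : ∀ q, 0 ≤ m q := fun q ↦ setIntegral_nonneg measurableSet_Ioi fun t (ht : 0 < t) ↦ by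
    positivity
  have hlt : ∀ q₀ q₁ a b : ℝ, 0 < q₀ → q₀ < q₁ → 0 < a → 0 < b → a + b = 1 →
      F q₀ ^ a * F q₁ ^ b ≤ F (a * q₀ + b * q₁) := by
    intro q₀ q₁ a b hq₀ hq ha hb hab
    have hq₁ := hq₀.trans hq
    rw [hF q₀ hq₀, hF q₁ hq₁, hF _ (by positivity)]
    rcases (hm0 q₀).eq_or_lt with h0 | h0
    · simp [← h0, ha]
    rcases (hm0 q₁).eq_or_lt with h1 | h1
    · simp [← h1, hb]
    have hG₀ := Gamma_pos_of_pos hq₀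
    have hG₁ := Gamma_pos_of_pos hq₁
    rw [ENNReal.ofReal_rpow_of_nonneg (by positivity) ha.le,
      ENNReal.ofReal_rpow_of_nonneg (by positivity) hb.le, ← ENNReal.ofReal_mul (by positivity)]
    exact ENNReal.ofReal_le_ofReal (gamma_normalized_moment_le_of_lt hlog'
      (fun q hq ↦ (setLIntegral_rpow_mul_eq_ofReal_integral hH hk hk0 hq).1) hq₀ hq h0 h1 ha hb hab)
  intro q₀ hq₀ q₁ hq₁ a b ha hb hab
  change F q₀ ^ a * F q₁ ^ b ≤ F (a * q₀ + b * q₁)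
  rcases lt_trichotomy q₀ q₁ with h | rfl | h
  · exact hlt q₀ q₁ a b hq₀ h ha hb hab
  · rw [← ENNReal.rpow_add_of_nonneg _ _ ha.le hb.le, ← add_mul, hab, one_mul, ENNReal.rpow_one]
  · rw [mul_comm, add_comm]
    exact hlt q₁ q₀ b a hq₁ h hb ha (by linarith)

/-- Borell's lemma: the Mellin transform of a log-concave function on the half-line, divided by the
Gamma function, is log-concave. -/
lemma ENNLogConcaveOn.gamma_normalized_moment {H : ℝ → ℝ≥0∞} (hH : Measurable H)
    (hlog : ENNLogConcaveOn (Set.Ioi 0) H) :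
    ENNLogConcaveOn (Set.Ioi 0) fun q ↦ (ENNReal.ofReal (Gamma q))⁻¹ *
      ∫⁻ t in Set.Ioi (0 : ℝ), ENNReal.ofReal (t ^ (q - 1)) * H t := by
  let T : ℕ → ℝ → ℝ≥0∞ := fun k ↦ (Set.Iic (k : ℝ)).indicator fun t ↦ min (H t) k
  have hT : ∀ k, Measurable (T k) := fun k ↦
    (hH.min measurable_const).indicator measurableSet_Iic
  have hTmono : Monotone T := by
    intro i j hij t
    have hij' : (i : ℝ) ≤ j := by exact_mod_cast hij
    refine (Set.indicator_le_indicator_of_subset (Set.Iic_subset_Iic.2 hij')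
      (fun _ ↦ zero_le) t).trans (Set.indicator_le_indicator ?_)
    exact min_le_min_left _ (by exact_mod_cast hij)
  have hTsup : ∀ t, ⨆ k, T k t = H t := by
    intro t
    refine tendsto_nhds_unique (tendsto_atTop_iSup fun i j hij ↦ hTmono hij t) ?_
    have h1 : Filter.Tendsto (fun k : ℕ ↦ min (H t) k) Filter.atTop (nhds (H t)) := by
      conv => enter [3]; rw [← ENNReal.iSup_min_natCast (H t)]
      exact tendsto_atTop_iSup fun i j hij ↦ min_le_min_left _ (by exact_mod_cast hij)
    refine h1.congr' ?_
    filter_upwards [Filter.eventually_ge_atTop ⌈t⌉₊] with k hk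
    have htk : t ∈ Set.Iic (k : ℝ) := Nat.ceil_le.1 hk
    simp [T, htk]
  have hTlog : ∀ k, ENNLogConcaveOn (Set.Ioi 0) (T k) := by
    intro k x hx y hy a b ha hb hab
    by_cases hxk : x ≤ k
    swap
    · simp [T, Set.indicator, hxk, ha]
    by_cases hyk : y ≤ k
    swap
    · simp [T, Set.indicator, hyk, hb]
    have hxy : a • x + b • y ∈ Set.Iic (k : ℝ) := (convex_Iic (k : ℝ)) hxk hyk ha.le hb.le hab
    change (Set.Iic (k : ℝ)).indicator (fun t ↦ min (H t) k) x ^ a *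
      (Set.Iic (k : ℝ)).indicator (fun t ↦ min (H t) k) y ^ b ≤
      (Set.Iic (k : ℝ)).indicator (fun t ↦ min (H t) k) (a • x + b • y)
    rw [Set.indicator_of_mem hxy, Set.indicator_of_mem (show x ∈ Set.Iic (k : ℝ) from hxk),
      Set.indicator_of_mem (show y ∈ Set.Iic (k : ℝ) from hyk)]
    refine le_min (le_trans ?_ (hlog x hx y hy a b ha hb hab)) ?_
    · gcongr <;> exact min_le_left _ _
    · calc min (H x) (k : ℝ≥0∞) ^ a * min (H y) (k : ℝ≥0∞) ^ b
          ≤ (k : ℝ≥0∞) ^ a * (k : ℝ≥0∞) ^ b := by gcongr <;> exact min_le_right _ _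
        _ = k := by
          rw [← ENNReal.rpow_add_of_nonneg _ _ ha.le hb.le, hab, ENNReal.rpow_one]
  have hmom : ∀ q : ℝ, (ENNReal.ofReal (Gamma q))⁻¹ *
      ∫⁻ t in Set.Ioi (0 : ℝ), ENNReal.ofReal (t ^ (q - 1)) * H t =
      ⨆ k, (ENNReal.ofReal (Gamma q))⁻¹ *
        ∫⁻ t in Set.Ioi (0 : ℝ), ENNReal.ofReal (t ^ (q - 1)) * T k t := by
    intro q
    rw [← ENNReal.mul_iSup, ← lintegral_iSup]
    · simp_rw [← ENNReal.mul_iSup, hTsup]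
    · intro k
      have := hT k
      fun_prop
    · exact fun i j hij t ↦ mul_le_mul_right (hTmono hij t) _
  have hmono : ∀ q : ℝ, Monotone fun k ↦ (ENNReal.ofReal (Gamma q))⁻¹ *
        ∫⁻ t in Set.Ioi (0 : ℝ), ENNReal.ofReal (t ^ (q - 1)) * T k t := fun q i j hij ↦
    mul_le_mul_right (lintegral_mono fun t ↦ mul_le_mul_right (hTmono hij t) _) _
  intro q₀ hq₀ q₁ hq₁ a b ha hb hab
  simp only [hmom]
  refine ENNReal.iSup_rpow_mul_iSup_rpow_le (hmono q₀) (hmono q₁) ha hb fun k ↦ ?_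
  refine le_trans ?_ (le_iSup _ k)
  refine (hTlog k).gamma_normalized_moment_of_bounded (hT k) (k := k) (fun t ↦ ?_) (fun t ht ↦ ?_)
    q₀ hq₀ q₁ hq₁ a b ha hb hab
  · exact Set.indicator_le' (fun _ _ ↦ min_le_right _ _) (fun _ _ ↦ zero_le) t
  · exact Set.indicator_of_notMem (fun h : t ∈ Set.Iic (k : ℝ) ↦ not_lt.2 h ht) _

lemma perspective_mem_and_le {E : Type*} [AddCommGroup E] [Module ℝ E] {C : Set E} {g : E → ℝ}
    (hg : ConvexOn ℝ C g) {t₀ t₁ a b : ℝ} (ht₀ : 0 < t₀) (ht₁ : 0 < t₁) (ha : 0 < a) (hb : 0 < b)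
    {y₀ y₁ : E} (hy₀ : t₀⁻¹ • y₀ ∈ C) (hy₁ : t₁⁻¹ • y₁ ∈ C) :
    (a * t₀ + b * t₁)⁻¹ • (a • y₀ + b • y₁) ∈ C ∧
      (a * t₀ + b * t₁) * g ((a * t₀ + b * t₁)⁻¹ • (a • y₀ + b • y₁)) ≤
        a * (t₀ * g (t₀⁻¹ • y₀)) + b * (t₁ * g (t₁⁻¹ • y₁)) := by
  have ht : 0 < a * t₀ + b * t₁ := by positivity
  set t := a * t₀ + b * t₁ with htdef
  have hw₀ : 0 ≤ a * t₀ / t := by positivity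
  have hw₁ : 0 ≤ b * t₁ / t := by positivity
  have hw : a * t₀ / t + b * t₁ / t = 1 := by rw [← add_div]; exact div_self ht.ne'
  have heq : t⁻¹ • (a • y₀ + b • y₁) =
      (a * t₀ / t) • (t₀⁻¹ • y₀) + (b * t₁ / t) • (t₁⁻¹ • y₁) := by
    simp only [smul_add, smul_smul]
    congr 2 <;> field_simp
  rw [heq]
  refine ⟨hg.1 hy₀ hy₁ hw₀ hw₁ hw, ?_⟩
  refine (mul_le_mul_of_nonneg_left (hg.2 hy₀ hy₁ hw₀ hw₁ hw) ht.le).trans_eq ?_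
  simp only [smul_eq_mul]
  field_simp

lemma lintegral_comp_inv_smul {n : ℕ} {φ : (Fin n → ℝ) → ℝ≥0∞} (hφ : Measurable φ) {t : ℝ}
    (ht : 0 < t) : ∫⁻ y, φ (t⁻¹ • y) = ENNReal.ofReal (t ^ n) * ∫⁻ x, φ x := by
  have := lintegral_map (μ := volume) hφ (measurable_const_smul (t⁻¹ : ℝ))
  rw [← this, Measure.map_addHaar_smul _ (inv_ne_zero ht.ne'), lintegral_smul_measure,
    Module.finrank_fin_fun, inv_pow, inv_inv, abs_of_pos (by positivity), smul_eq_mul]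

section

variable {n : ℕ} {C : Set (Fin n → ℝ)} {g : (Fin n → ℝ) → ℝ}

lemma ENNLogConcaveOn.pow_mul_lintegral_exp_neg (hC : MeasurableSet C) (hgm : Measurable g)
    (hg : ConvexOn ℝ C g) :
    ENNLogConcaveOn (Set.Ioi 0) fun t ↦
      ENNReal.ofReal (t ^ n) * ∫⁻ x in C, ENNReal.ofReal (exp (-(g x * t))) := by
  let φ : ℝ → (Fin n → ℝ) → ℝ≥0∞ := fun t ↦ C.indicator fun x ↦ ENNReal.ofReal (exp (-(g x * t)))
  have hφ : ∀ t, Measurable (φ t) := fun t ↦ Measurable.indicator (by fun_prop) hC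
  have hF : ∀ t : ℝ, 0 < t → ENNReal.ofReal (t ^ n) * ∫⁻ x in C, ENNReal.ofReal (exp (-(g x * t))) =
      ∫⁻ y, φ t (t⁻¹ • y) := by
    intro t ht
    rw [lintegral_comp_inv_smul (hφ t) ht, lintegral_indicator hC]
  intro t₀ ht₀ t₁ ht₁ a b ha hb hab
  simp only
  rw [Set.mem_Ioi] at ht₀ ht₁
  rw [hF t₀ ht₀, hF t₁ ht₁, hF (a • t₀ + b • t₁) (by simp only [smul_eq_mul]; positivity)]
  refine prekopaLeindler_pi n ha hb hab ((hφ _).comp (measurable_const_smul _))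
    ((hφ _).comp (measurable_const_smul _)) ((hφ _).comp (measurable_const_smul _)) fun y₀ y₁ ↦ ?_
  by_cases hy₀ : t₀⁻¹ • y₀ ∈ C
  swap
  · simp [φ, hy₀, ha]
  by_cases hy₁ : t₁⁻¹ • y₁ ∈ C
  swap
  · simp [φ, hy₁, hb]
  obtain ⟨hy, hle⟩ := perspective_mem_and_le hg ht₀ ht₁ ha hb hy₀ hy₁
  simp only [φ, smul_eq_mul, Set.indicator_of_mem hy₀, Set.indicator_of_mem hy₁,
    Set.indicator_of_mem hy]
  rw [ENNReal.ofReal_rpow_of_nonneg (exp_pos _).le ha.le,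
    ENNReal.ofReal_rpow_of_nonneg (exp_pos _).le hb.le, ← ENNReal.ofReal_mul (by positivity),
    ← Real.exp_mul, ← Real.exp_mul, ← Real.exp_add]
  refine ENNReal.ofReal_le_ofReal (Real.exp_le_exp.2 ?_)
  linarith

lemma Real.Gamma_add_natCast_add_one {q : ℝ} (hq : 0 < q) (n : ℕ) :
    Gamma (q + n + 1) = (∏ i ∈ Finset.Icc 1 n, (q + i)) * Gamma (q + 1) := by
  induction n with
  | zero => simp
  | succ n ih =>
    rw [Finset.prod_Icc_succ_top (by omega), mul_right_comm, ← ih, Nat.cast_succ, ← add_assoc,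
      Real.Gamma_add_one (s := q + n + 1) (by positivity)]
    ring

lemma Real.Gamma_eq_prod_sub_mul_Gamma_sub {q : ℝ} (n : ℕ) (hq : n < q) :
    Gamma q = (∏ i ∈ Finset.Icc 1 n, (q - i)) * Gamma (q - n) := by
  induction n with
  | zero => simp
  | succ n ih =>
    push_cast at hq
    rw [Finset.prod_Icc_succ_top (by omega), ih (by linarith), Nat.cast_succ]
    have : q - n = q - (n + 1) + 1 := by ring
    rw [this, Real.Gamma_add_one (by linarith)]
    ring

lemma setLIntegral_rpow_mul_exp_neg_mul {q r : ℝ} (hq : 0 < q) (hr : 0 < r) :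
    ∫⁻ t in Set.Ioi (0 : ℝ), ENNReal.ofReal (t ^ (q - 1)) * ENNReal.ofReal (exp (-(r * t))) =
      ENNReal.ofReal (r ^ (-q) * Gamma q) := by
  have h := Real.integral_rpow_mul_exp_neg_mul_Ioi hq hr
  rw [one_div, Real.inv_rpow hr.le, ← Real.rpow_neg hr.le] at h
  rw [← h, ofReal_integral_eq_lintegral_ofReal (integrableOn_rpow_mul_exp_neg_mul_Ioi hq hr)]
  · refine setLIntegral_congr_fun measurableSet_Ioi fun t (ht : 0 < t) ↦ ?_
    rw [ENNReal.ofReal_mul (by positivity)]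
  · refine (ae_restrict_iff' measurableSet_Ioi).2 (.of_forall fun t (ht : 0 < t) ↦ ?_)
    simp only [Pi.zero_apply]
    positivity

lemma ENNLogConcaveOn.prod_sub_mul_lintegral_rpow_neg (hC : MeasurableSet C) (hgm : Measurable g)
    (hg : ConvexOn ℝ C g) (hpos : ∀ x ∈ C, 0 < g x) :
    ENNLogConcaveOn (Set.Ioi (n : ℝ)) fun q ↦
      ENNReal.ofReal (∏ i ∈ Finset.Icc 1 n, (q - i)) *
        ∫⁻ x in C, ENNReal.ofReal (g x ^ (-q)) := by
  let J : ℝ → ℝ≥0∞ := fun t ↦ ∫⁻ x in C, ENNReal.ofReal (exp (-(g x * t)))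
  have hJ : Measurable J := Measurable.lintegral_prod_right'
    (f := fun z : ℝ × (Fin n → ℝ) ↦ ENNReal.ofReal (exp (-(g z.2 * z.1)))) (by fun_prop)
  have hlog : ENNLogConcaveOn (Set.Ioi 0) fun t ↦ ENNReal.ofReal (t ^ n) * J t :=
    .pow_mul_lintegral_exp_neg hC hgm hg
  have hborell := hlog.gamma_normalized_moment (by fun_prop)
  have hF : ∀ q : ℝ, n < q → ENNReal.ofReal (∏ i ∈ Finset.Icc 1 n, (q - i)) *
        ∫⁻ x in C, ENNReal.ofReal (g x ^ (-q)) = (ENNReal.ofReal (Gamma (q - n)))⁻¹ *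
        ∫⁻ t in Set.Ioi (0 : ℝ), ENNReal.ofReal (t ^ (q - n - 1)) *
          (ENNReal.ofReal (t ^ n) * J t) := by
    intro q hq
    have hq0 : 0 < q := lt_of_le_of_lt (by positivity) hq
    have hG : 0 < Gamma (q - n) := Gamma_pos_of_pos (sub_pos.2 hq)
    have hGq := Gamma_pos_of_pos hq0
    have h1 : ∫⁻ t in Set.Ioi (0 : ℝ), ENNReal.ofReal (t ^ (q - n - 1)) *
          (ENNReal.ofReal (t ^ n) * J t) =
        ∫⁻ t in Set.Ioi (0 : ℝ), ∫⁻ x in C,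
          ENNReal.ofReal (t ^ (q - 1)) * ENNReal.ofReal (exp (-(g x * t))) := by
      refine setLIntegral_congr_fun measurableSet_Ioi fun t (ht : 0 < t) ↦ ?_
      rw [lintegral_const_mul _ (by fun_prop), ← mul_assoc, ← ENNReal.ofReal_mul (by positivity),
        ← Real.rpow_natCast t n, ← Real.rpow_add ht]
      congr 3
      ring
    have h2 : ∫⁻ x in C, ∫⁻ t in Set.Ioi (0 : ℝ),
          ENNReal.ofReal (t ^ (q - 1)) * ENNReal.ofReal (exp (-(g x * t))) =
        (∫⁻ x in C, ENNReal.ofReal (g x ^ (-q))) * ENNReal.ofReal (Gamma q) := by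
      rw [← lintegral_mul_const _ (by fun_prop)]
      refine setLIntegral_congr_fun hC fun x hx ↦ ?_
      rw [setLIntegral_rpow_mul_exp_neg_mul hq0 (hpos x hx),
        ENNReal.ofReal_mul (Real.rpow_nonneg (hpos x hx).le _)]
    rw [h1, lintegral_lintegral_swap (by fun_prop), h2, Real.Gamma_eq_prod_sub_mul_Gamma_sub n hq,
      ENNReal.ofReal_mul' hG.le, mul_comm, mul_comm (ENNReal.ofReal _)⁻¹, mul_assoc, mul_assoc,
      ENNReal.mul_inv_cancel (by simpa using hG) ENNReal.ofReal_ne_top, mul_one]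
  intro q₀ hq₀ q₁ hq₁ a b ha hb hab
  rw [Set.mem_Ioi] at hq₀ hq₁
  have hq : (n : ℝ) < a • q₀ + b • q₁ := convex_Ioi (n : ℝ) hq₀ hq₁ ha.le hb.le hab
  simp only
  rw [hF q₀ hq₀, hF q₁ hq₁, hF _ hq]
  have := hborell (q₀ - n) (sub_pos.2 hq₀) (q₁ - n) (sub_pos.2 hq₁) a b ha hb hab
  have heq : a • (q₀ - n) + b • (q₁ - n) = a • q₀ + b • q₁ - n := by
    simp only [smul_eq_mul]
    linear_combination (-(n : ℝ)) * hab
  rwa [heq] at this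

lemma setLIntegral_rpow_sub_one_mul_indicator_Iio {q c : ℝ} (hq : 0 < q) (hc : 0 < c)
    (w : ℝ≥0∞) :
    ∫⁻ u in Set.Ioi (0 : ℝ), ENNReal.ofReal (u ^ (q - 1)) * (Set.Iio c).indicator (fun _ ↦ w) u =
      ENNReal.ofReal (c ^ q / q) * w := by
  have hinteg : IntegrableOn (fun u : ℝ ↦ u ^ (q - 1)) (Set.Ioc 0 c) :=
    (intervalIntegral.intervalIntegrable_rpow' (a := 0) (b := c) (by linarith)).1
  have hval : ∫ u in Set.Ioc 0 c, u ^ (q - 1) = c ^ q / q := by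
    rw [← intervalIntegral.integral_of_le hc.le, integral_rpow (.inl (by linarith)),
      sub_add_cancel, Real.zero_rpow hq.ne', sub_zero]
  rw [← hval, ofReal_integral_eq_lintegral_ofReal hinteg, setLIntegral_congr Ioo_ae_eq_Ioc.symm,
    ← lintegral_mul_const _ (by fun_prop), ← lintegral_indicator measurableSet_Ioi,
    ← lintegral_indicator measurableSet_Ioo]
  · refine lintegral_congr fun u ↦ ?_
    by_cases h0 : 0 < u <;> by_cases h1 : u < c <;> simp [Set.indicator, h0, h1]
  · refine (ae_restrict_iff' measurableSet_Ioc).2 (.of_forall fun t ht ↦ ?_)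
    exact Real.rpow_nonneg ht.1.le _

lemma ENNLogConcaveOn.prod_add_mul_lintegral_rpow (hC : MeasurableSet C) (hgm : Measurable g)
    (hg : ConcaveOn ℝ C g) (hpos : ∀ x ∈ C, 0 < g x) :
    ENNLogConcaveOn (Set.Ioi 0) fun q ↦
      ENNReal.ofReal (∏ i ∈ Finset.Icc 1 n, (q + i)) * ∫⁻ x in C, ENNReal.ofReal (g x ^ q) := by
  let V : Set (ℝ × ℝ × (Fin n → ℝ)) :=
    {z | 0 < z.2.1 ∧ z.2.1⁻¹ • z.2.2 ∈ C ∧ z.1 < z.2.1 * g (z.2.1⁻¹ • z.2.2)}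
  have hV : MeasurableSet V := by
    have h1 : Measurable fun z : ℝ × ℝ × (Fin n → ℝ) ↦ z.2.1 := by fun_prop
    have h2 : Measurable fun z : ℝ × ℝ × (Fin n → ℝ) ↦ z.2.1⁻¹ • z.2.2 := by fun_prop
    exact (measurableSet_lt measurable_const h1).inter
      ((hC.preimage h2).inter (measurableSet_lt measurable_fst (h1.mul (hgm.comp h2))))
  let W : ℝ × ℝ × (Fin n → ℝ) → ℝ≥0∞ := V.indicator fun z ↦ ENNReal.ofReal (exp (-z.2.1))
  have hW : Measurable W := Measurable.indicator (by fun_prop) hV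
  let H : ℝ → ℝ≥0∞ := fun u ↦ ∫⁻ z : ℝ × (Fin n → ℝ), W (u, z) ∂(volume.prod volume)
  have hH : Measurable H := hW.lintegral_prod_right'
  have hlog : ENNLogConcaveOn (Set.Ioi 0) H := by
    intro u₀ _ u₁ _ a b ha hb hab
    refine (prekopaLeindler_real.prod (prekopaLeindler_pi n)) ha hb hab
      (hW.comp measurable_prodMk_left) (hW.comp measurable_prodMk_left)
      (hW.comp measurable_prodMk_left) ?_
    rintro ⟨r₀, y₀⟩ ⟨r₁, y₁⟩
    by_cases h₀ : (u₀, r₀, y₀) ∈ V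
    swap
    · simp [W, h₀, ha]
    by_cases h₁ : (u₁, r₁, y₁) ∈ V
    swap
    · simp [W, h₁, hb]
    obtain ⟨hr₀, hy₀, hu₀⟩ := id h₀
    obtain ⟨hr₁, hy₁, hu₁⟩ := id h₁
    simp only at hr₀ hy₀ hu₀ hr₁ hy₁ hu₁
    obtain ⟨hy, hle⟩ := perspective_mem_and_le hg.neg hr₀ hr₁ ha hb hy₀ hy₁
    have h : (a • u₀ + b • u₁, a • r₀ + b • r₁, a • y₀ + b • y₁) ∈ V := by
      refine ⟨by simp only [smul_eq_mul]; positivity, hy, ?_⟩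
      simp only [smul_eq_mul, Pi.neg_apply] at hle ⊢
      have e₀ := mul_lt_mul_of_pos_left hu₀ ha
      have e₁ := mul_lt_mul_of_pos_left hu₁ hb
      linarith
    simp only [W, Set.indicator_of_mem h₀, Set.indicator_of_mem h₁, Prod.smul_mk, Prod.mk_add_mk,
      Set.indicator_of_mem h]
    rw [ENNReal.ofReal_rpow_of_nonneg (exp_pos _).le ha.le,
      ENNReal.ofReal_rpow_of_nonneg (exp_pos _).le hb.le, ← ENNReal.ofReal_mul (by positivity),
      ← Real.exp_mul, ← Real.exp_mul, ← Real.exp_add]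
    refine ENNReal.ofReal_le_ofReal (Real.exp_le_exp.2 ?_)
    simp only [smul_eq_mul]
    linarith
  have hborell := hlog.gamma_normalized_moment hH
  have hF : ∀ q : ℝ, 0 < q → ENNReal.ofReal (∏ i ∈ Finset.Icc 1 n, (q + i)) *
      ∫⁻ x in C, ENNReal.ofReal (g x ^ q) = (ENNReal.ofReal (Gamma q))⁻¹ *
        ∫⁻ u in Set.Ioi (0 : ℝ), ENNReal.ofReal (u ^ (q - 1)) * H u := by
    intro q hq
    let φ : ℝ → (Fin n → ℝ) → ℝ≥0∞ := fun r ↦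
      C.indicator fun x ↦ ENNReal.ofReal ((r * g x) ^ q / q) * ENNReal.ofReal (exp (-r))
    have hφ : ∀ r, Measurable (φ r) := fun r ↦ Measurable.indicator (by fun_prop) hC
    have hinner : ∀ r y, ∫⁻ u in Set.Ioi (0 : ℝ), ENNReal.ofReal (u ^ (q - 1)) * W (u, r, y) =
        (Set.Ioi (0 : ℝ)).indicator (fun r ↦ φ r (r⁻¹ • y)) r := by
      intro r y
      by_cases hr : 0 < r
      swap
      · simp [W, V, Set.indicator, hr]
      by_cases hy : r⁻¹ • y ∈ C
      swap
      · simp [W, V, φ, Set.indicator, hy]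
      have hWu : ∀ u, W (u, r, y) = (Set.Iio (r * g (r⁻¹ • y))).indicator
          (fun _ ↦ ENNReal.ofReal (exp (-r))) u := by
        intro u
        simp [W, V, Set.indicator, hr, hy]
      simp only [hWu]
      rw [setLIntegral_rpow_sub_one_mul_indicator_Iio hq (mul_pos hr (hpos _ hy))]
      simp [φ, hr, hy]
    have hmeas : Measurable fun z : ℝ × (Fin n → ℝ) ↦
        ∫⁻ u in Set.Ioi (0 : ℝ), ENNReal.ofReal (u ^ (q - 1)) * W (u, z) :=
      Measurable.lintegral_prod_left'
        (f := fun z : ℝ × ℝ × (Fin n → ℝ) ↦ ENNReal.ofReal (z.1 ^ (q - 1)) * W z) (by fun_prop)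
    have h1 : ∫⁻ u in Set.Ioi (0 : ℝ), ENNReal.ofReal (u ^ (q - 1)) * H u =
        ∫⁻ r in Set.Ioi (0 : ℝ), ∫⁻ y, φ r (r⁻¹ • y) := by
      calc ∫⁻ u in Set.Ioi (0 : ℝ), ENNReal.ofReal (u ^ (q - 1)) * H u
          = ∫⁻ u in Set.Ioi (0 : ℝ), ∫⁻ z : ℝ × (Fin n → ℝ),
              ENNReal.ofReal (u ^ (q - 1)) * W (u, z) ∂(volume.prod volume) :=
            lintegral_congr fun u ↦
              (lintegral_const_mul _ (hW.comp measurable_prodMk_left)).symm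
        _ = ∫⁻ r, ∫⁻ y, (Set.Ioi (0 : ℝ)).indicator (fun r ↦ φ r (r⁻¹ • y)) r := by
            rw [lintegral_lintegral_swap (by fun_prop), lintegral_prod _ hmeas.aemeasurable]
            simp only [hinner]
        _ = ∫⁻ r in Set.Ioi (0 : ℝ), ∫⁻ y, φ r (r⁻¹ • y) := by
            rw [← lintegral_indicator measurableSet_Ioi]
            refine lintegral_congr fun r ↦ ?_
            by_cases hr : 0 < r <;> simp [Set.indicator, hr]
    have h2 : ∀ r : ℝ, 0 < r → ∫⁻ y, φ r (r⁻¹ • y) =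
        ENNReal.ofReal (r ^ (q + n + 1 - 1)) * ENNReal.ofReal (exp (-(1 * r))) *
          (ENNReal.ofReal q⁻¹ * ∫⁻ x in C, ENNReal.ofReal (g x ^ q)) := by
      intro r hr
      rw [lintegral_comp_inv_smul (hφ r) hr, lintegral_indicator hC, one_mul,
        ← lintegral_const_mul _ (by fun_prop), ← lintegral_const_mul _ (by fun_prop),
        ← lintegral_const_mul _ (by fun_prop)]
      refine setLIntegral_congr_fun hC fun x hx ↦ ?_
      have hgx := (hpos x hx).le
      rw [← ENNReal.ofReal_mul (by positivity), ← ENNReal.ofReal_mul (by positivity),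
        ← ENNReal.ofReal_mul (by positivity), ← ENNReal.ofReal_mul (by positivity),
        ← ENNReal.ofReal_mul (by positivity), add_sub_cancel_right, Real.rpow_add hr,
        Real.rpow_natCast, Real.mul_rpow hr.le hgx]
      congr 1
      field_simp
    have hG := Gamma_pos_of_pos hq
    rw [h1, setLIntegral_congr_fun measurableSet_Ioi h2, lintegral_mul_const _ (by fun_prop),
      setLIntegral_rpow_mul_exp_neg_mul (by positivity) one_pos, Real.one_rpow, one_mul,
      ← mul_assoc, ← mul_assoc, Real.Gamma_add_natCast_add_one hq, Real.Gamma_add_one hq.ne',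
      ← ENNReal.ofReal_inv_of_pos hG, ← ENNReal.ofReal_mul (by positivity),
      ← ENNReal.ofReal_mul (by positivity)]
    congr 2
    field_simp
  intro q₀ hq₀ q₁ hq₁ a b ha hb hab
  rw [Set.mem_Ioi] at hq₀ hq₁
  have hq : 0 < a • q₀ + b • q₁ := by simp only [smul_eq_mul]; positivity
  simp only
  rw [hF q₀ hq₀, hF q₁ hq₁, hF _ hq]
  exact hborell q₀ hq₀ q₁ hq₁ a b ha hb hab

end

section SConcave

lemma sMean_pos {s lam a b : ℝ} (ha : 0 < a) (hb : 0 < b) (hlam : lam ∈ Set.Icc (0 : ℝ) 1) :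
    0 < sMean s lam a b := by
  have hmean : 0 < (1 - lam) * a ^ s + lam * b ^ s := by
    have ha' := rpow_pos_of_pos ha s
    have hb' := rpow_pos_of_pos hb s
    rcases hlam.1.eq_or_lt with h | h
    · simpa [← h]
    · exact add_pos_of_nonneg_of_pos (mul_nonneg (sub_nonneg.2 hlam.2) ha'.le) (mul_pos h hb')
  unfold sMean
  split_ifs
  · positivity
  · positivity

variable {E : Type*} [AddCommGroup E] [Module ℝ E] {s : ℝ} {f : E → ℝ}

lemma IsSConcave.sMean_le (hf : IsSConcave s f) {x y : E} (hx : 0 < f x) (hy : 0 < f y)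
    {a b : ℝ} (ha : 0 ≤ a) (hb : 0 ≤ b) (hab : a + b = 1) :
    sMean s b (f x) (f y) ≤ f (a • x + b • y) := by
  have h := hf x y hx hy b ⟨hb, by linarith⟩
  rwa [show 1 - b = a by linarith] at h

lemma IsSConcave.convex_pos (hf : IsSConcave s f) : Convex ℝ {x | 0 < f x} :=
  fun _ hx _ hy _ _ ha hb hab ↦
    (sMean_pos hx hy ⟨hb, by linarith⟩).trans_le (hf.sMean_le hx hy ha hb hab)

lemma IsSConcave.convexOn_neg_log (hf : IsSConcave 0 f) :
    ConvexOn ℝ {x | 0 < f x} fun x ↦ -log (f x) := by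
  refine ⟨hf.convex_pos, fun x hx y hy a b ha hb hab ↦ ?_⟩
  have hx' : 0 < f x := hx
  have hy' : 0 < f y := hy
  have h := log_le_log (sMean_pos hx' hy' ⟨hb, by linarith⟩) (hf.sMean_le hx hy ha hb hab)
  rw [sMean, if_pos rfl, log_mul (by positivity) (by positivity), log_rpow hx', log_rpow hy',
    show 1 - b = a by linarith] at h
  simp only [smul_eq_mul]
  linarith

lemma IsSConcave.concaveOn_rpow (hf : IsSConcave s f) (hs : 0 < s) :
    ConcaveOn ℝ {x | 0 < f x} fun x ↦ f x ^ s := by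
  refine ⟨hf.convex_pos, fun x hx y hy a b ha hb hab ↦ ?_⟩
  have hx' : 0 < f x := hx
  have hy' : 0 < f y := hy
  have h := rpow_le_rpow (sMean_pos hx' hy' ⟨hb, by linarith⟩).le
    (hf.sMean_le hx hy ha hb hab) hs.le
  rwa [sMean, if_neg hs.ne', show 1 - b = a by linarith, ← rpow_mul (by positivity),
    one_div_mul_cancel hs.ne', rpow_one] at h

lemma IsSConcave.convexOn_rpow (hf : IsSConcave s f) (hs : s < 0) :
    ConvexOn ℝ {x | 0 < f x} fun x ↦ f x ^ s := by
  refine ⟨hf.convex_pos, fun x hx y hy a b ha hb hab ↦ ?_⟩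
  have hx' : 0 < f x := hx
  have hy' : 0 < f y := hy
  have h := rpow_le_rpow_of_nonpos (sMean_pos hx' hy' ⟨hb, by linarith⟩)
    (hf.sMean_le hx hy ha hb hab) hs.le
  rwa [sMean, if_neg hs.ne, show 1 - b = a by linarith, ← rpow_mul (by positivity),
    one_div_mul_cancel hs.ne, rpow_one] at h

end SConcave

lemma ENNLogConcaveOn.of_eq_const_mul_comp {S T : Set ℝ} {F G : ℝ → ℝ≥0∞}
    (hF : ENNLogConcaveOn S F) (hT : Convex ℝ T) (c : ℝ) (k : ℝ≥0∞)
    (h : ∀ p ∈ T, c * p ∈ S ∧ G p = k * F (c * p)) : ENNLogConcaveOn T G := by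
  intro x hx y hy a b ha hb hab
  rw [(h _ hx).2, (h _ hy).2, (h _ (hT hx hy ha.le hb.le hab)).2,
    ENNReal.mul_rpow_of_nonneg _ _ ha.le, ENNReal.mul_rpow_of_nonneg _ _ hb.le, mul_mul_mul_comm,
    ← ENNReal.rpow_add_of_nonneg _ _ ha.le hb.le, hab, ENNReal.rpow_one]
  gcongr
  have hlin : c * (a • x + b • y) = a • (c * x) + b • (c * y) := by
    simp only [smul_eq_mul]
    ring
  rw [hlin]
  exact hF _ (h _ hx).1 _ (h _ hy).1 a b ha hb hab

lemma pow_mul_prod_Icc (c : ℝ) (n : ℕ) (h : ℕ → ℝ) :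
    c ^ n * ∏ i ∈ Finset.Icc 1 n, h i = ∏ i ∈ Finset.Icc 1 n, c * h i := by
  simp [Finset.prod_mul_distrib]

section Euclidean

variable {n : ℕ} {s : ℝ} {f : (Fin n → ℝ) → ℝ}

lemma lintegral_rpow_eq_setLIntegral_interior (hf_nonneg : ∀ x, 0 ≤ f x)
    (hf : IsSConcave s f) {p : ℝ} (hp : 0 < p) :
    ∫⁻ x, ENNReal.ofReal (f x ^ p) =
      ∫⁻ x in interior {x | 0 < f x}, ENNReal.ofReal (f x ^ p) := by
  rw [← lintegral_indicator isOpen_interior.measurableSet]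
  refine lintegral_congr_ae ?_
  filter_upwards [measure_eq_zero_iff_ae_notMem.1 (hf.convex_pos.addHaar_frontier volume)] with x hx
  by_cases hxi : x ∈ interior {x | 0 < f x}
  · rw [Set.indicator_of_mem hxi]
  · have hfx : f x = 0 := by
      by_contra h0
      exact hx ⟨subset_closure ((hf_nonneg x).lt_of_ne' h0), hxi⟩
    rw [Set.indicator_of_notMem hxi, hfx, zero_rpow hp.ne', ENNReal.ofReal_zero]

lemma ContinuousOn.measurable_indicator {C : Set (Fin n → ℝ)} {g : (Fin n → ℝ) → ℝ}
    (hg : ContinuousOn g C) (hC : MeasurableSet C) : Measurable (C.indicator g) := by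
  classical
  rw [← Set.piecewise_eq_indicator]
  exact hg.measurable_piecewise continuousOn_const hC

lemma IsSConcave.ennLogConcaveOn_prod_mul_lintegral_rpow (hf_nonneg : ∀ x, 0 ≤ f x)
    (hf : IsSConcave s f) :
    ENNLogConcaveOn (Set.Ioi (max 0 (-(n * s)))) fun p ↦
      ENNReal.ofReal (∏ i ∈ Finset.Icc 1 n, (p + (i : ℝ) * s)) *
        ∫⁻ x, ENNReal.ofReal (f x ^ p) := by
  set C := interior {x | 0 < f x} with hC
  have hCo : IsOpen C := isOpen_interior
  have hCm : MeasurableSet C := hCo.measurableSet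
  have hCsub : C ⊆ {x | 0 < f x} := interior_subset
  have hCpos : ∀ x ∈ C, 0 < f x := fun x hx ↦ hCsub hx
  have hCc : Convex ℝ C := hf.convex_pos.interior
  have hind (g : (Fin n → ℝ) → ℝ) : Set.EqOn g (C.indicator g) C :=
    fun x hx ↦ (Set.indicator_of_mem hx g).symm
  rcases lt_trichotomy s 0 with hs | rfl | hs
  · have hg := (hf.convexOn_rpow hs).subset hCsub hCc
    refine ENNLogConcaveOn.of_eq_const_mul_comp
      (ENNLogConcaveOn.prod_sub_mul_lintegral_rpow_neg hCm
        ((hg.continuousOn hCo).measurable_indicator hCm) (hg.congr (hind _))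
        fun x hx ↦ by rw [← hind _ hx]; exact rpow_pos_of_pos (hCpos x hx) s)
      (convex_Ioi _) (-s)⁻¹ (ENNReal.ofReal ((-s) ^ n)) fun p hp ↦ ?_
    have hp' := max_lt_iff.1 (Set.mem_Ioi.1 hp)
    have hs' : 0 < -s := neg_pos.2 hs
    have hs0 : s ≠ 0 := hs.ne
    refine ⟨?_, ?_⟩
    · rw [Set.mem_Ioi, inv_mul_eq_div, lt_div_iff₀ hs']
      linarith [hp'.2]
    · rw [lintegral_rpow_eq_setLIntegral_interior hf_nonneg hf hp'.1, ← mul_assoc,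
        ← ENNReal.ofReal_mul (by positivity)]
      congr 1
      · rw [pow_mul_prod_Icc]
        congr 1
        refine Finset.prod_congr rfl fun i _ ↦ ?_
        field_simp
        ring
      · refine setLIntegral_congr_fun hCm fun x hx ↦ ?_
        rw [← hind _ hx, ← rpow_mul (hf_nonneg x)]
        congr 2
        field_simp
  · have hg := hf.convexOn_neg_log.subset hCsub hCc
    refine ENNLogConcaveOn.of_eq_const_mul_comp
      (ENNLogConcaveOn.pow_mul_lintegral_exp_neg hCm
        ((hg.continuousOn hCo).measurable_indicator hCm) (hg.congr (hind _)))
      (convex_Ioi _) 1 1 fun p hp ↦ ?_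
    have hp' := max_lt_iff.1 (Set.mem_Ioi.1 hp)
    refine ⟨by simpa using hp'.1, ?_⟩
    rw [lintegral_rpow_eq_setLIntegral_interior hf_nonneg hf hp'.1, one_mul, one_mul]
    congr 1
    · simp
    · refine setLIntegral_congr_fun hCm fun x hx ↦ ?_
      rw [← hind _ hx, rpow_def_of_pos (hCpos x hx), neg_mul, neg_neg]
  · have hg := (hf.concaveOn_rpow hs).subset hCsub hCc
    refine ENNLogConcaveOn.of_eq_const_mul_comp
      (ENNLogConcaveOn.prod_add_mul_lintegral_rpow hCm
        ((hg.continuousOn hCo).measurable_indicator hCm) (hg.congr (hind _))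
        fun x hx ↦ by rw [← hind _ hx]; exact rpow_pos_of_pos (hCpos x hx) s)
      (convex_Ioi _) s⁻¹ (ENNReal.ofReal (s ^ n)) fun p hp ↦ ?_
    have hp' := max_lt_iff.1 (Set.mem_Ioi.1 hp)
    refine ⟨mul_pos (inv_pos.2 hs) hp'.1, ?_⟩
    rw [lintegral_rpow_eq_setLIntegral_interior hf_nonneg hf hp'.1, ← mul_assoc,
      ← ENNReal.ofReal_mul (by positivity)]
    congr 1
    · rw [pow_mul_prod_Icc]
      congr 1
      refine Finset.prod_congr rfl fun i _ ↦ ?_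
      field_simp
    · refine setLIntegral_congr_fun hCm fun x hx ↦ ?_
      rw [← hind _ hx, ← rpow_mul (hf_nonneg x), mul_inv_cancel_left₀ hs.ne']

end Euclidean

lemma ENNLogConcaveOn.eq_top_of_eq_top {c : ℝ} {F : ℝ → ℝ≥0∞}
    (hF : ENNLogConcaveOn (Set.Ioi c) F) (hpos : ∀ p ∈ Set.Ioi c, F p ≠ 0) {p q : ℝ}
    (hp : p ∈ Set.Ioi c) (hq : q ∈ Set.Ioi c) (htop : F q = ∞) : F p = ∞ := by
  rcases eq_or_ne p q with rfl | hpq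
  · exact htop
  obtain ⟨r, hr, a, b, ha, hb, hab, rfl⟩ : ∃ r ∈ Set.Ioi c, ∃ a b : ℝ,
      0 < a ∧ 0 < b ∧ a + b = 1 ∧ a • q + b • r = p := by
    obtain ⟨r, hr, hpr⟩ : ∃ r ∈ Set.Ioi c, p ∈ openSegment ℝ q r := by
      rcases hpq.lt_or_gt with h | h
      · obtain ⟨r, hcr, hrp⟩ := exists_between (Set.mem_Ioi.1 hp)
        refine ⟨r, hcr, ?_⟩
        rw [openSegment_symm, openSegment_eq_Ioo (hrp.trans h)]
        exact ⟨hrp, h⟩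
      · refine ⟨p + 1, (Set.mem_Ioi.1 hp).trans (lt_add_one p), ?_⟩
        rw [openSegment_eq_Ioo (h.trans (lt_add_one p))]
        exact ⟨h, lt_add_one p⟩
    exact ⟨r, hr, hpr⟩
  have h := hF q hq r hr a b ha hb hab
  rw [htop, ENNReal.top_rpow_of_pos ha, ENNReal.top_mul] at h
  · exact top_le_iff.1 h
  · exact fun h0 ↦ hpos r hr ((ENNReal.rpow_eq_zero_iff_of_pos hb).1 h0)

lemma ENNLogConcaveOn.concaveOn_log_toReal {c : ℝ} {F : ℝ → ℝ≥0∞}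
    (hF : ENNLogConcaveOn (Set.Ioi c) F) (hpos : ∀ p ∈ Set.Ioi c, F p ≠ 0) :
    ConcaveOn ℝ (Set.Ioi c) fun p ↦ log (F p).toReal := by
  by_cases htop : ∃ q ∈ Set.Ioi c, F q = ∞
  · obtain ⟨q, hq, hqtop⟩ := htop
    refine (concaveOn_const 0 (convex_Ioi c)).congr fun p hp ↦ ?_
    simp [hF.eq_top_of_eq_top hpos hp hq hqtop]
  push Not at htop
  refine concaveOn_iff_forall_pos.2 ⟨convex_Ioi c, fun x hx y hy a b ha hb hab ↦ ?_⟩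
  have hxy := convex_Ioi c hx hy ha.le hb.le hab
  have h := ENNReal.toReal_mono (htop _ hxy) (hF x hx y hy a b ha hb hab)
  have hx0 := ENNReal.toReal_pos (hpos x hx) (htop x hx)
  have hy0 := ENNReal.toReal_pos (hpos y hy) (htop y hy)
  rw [ENNReal.toReal_mul, ← ENNReal.toReal_rpow, ← ENNReal.toReal_rpow] at h
  have hlog := log_le_log (by positivity) h
  rwa [log_mul (by positivity) (by positivity), log_rpow hx0, log_rpow hy0] at hlog

/-- For an integrable `s`-concave function `f : ℝⁿ → [0,∞)`, the function
`p ↦ (p+s)(p+2s)⋯(p+ns) ∫ f^p` is log-concave for `p > max(0, -ns)`. -/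
theorem stmt7
    (n : ℕ) (s : ℝ) (f : (Fin n → ℝ) → ℝ)
    (hf_nonneg : ∀ x, 0 ≤ f x)
    (hf_int : Integrable f)
    (hf_sconc : IsSConcave s f) :
    ConcaveOn ℝ (Set.Ioi (max 0 (-(n * s))))
      (fun p => Real.log
        ((∏ i ∈ Finset.Icc 1 n, (p + (i : ℝ) * s)) * ∫ x, f x ^ p)) := by
  have hinteg (p : ℝ) : ∫ x, f x ^ p = (∫⁻ x, ENNReal.ofReal (f x ^ p)).toReal :=
    integral_eq_lintegral_of_nonneg_ae (.of_forall fun x ↦ rpow_nonneg (hf_nonneg x) p)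
      (hf_int.aemeasurable.pow_const p).aestronglyMeasurable
  have hprod : ∀ p ∈ Set.Ioi (max 0 (-(n * s))), 0 < ∏ i ∈ Finset.Icc 1 n, (p + (i : ℝ) * s) := by
    intro p hp
    obtain ⟨hp0, hpn⟩ := max_lt_iff.1 (Set.mem_Ioi.1 hp)
    refine Finset.prod_pos fun i hi ↦ ?_
    rcases le_or_gt 0 s with hs | hs
    · positivity
    · have hin : (i : ℝ) ≤ n := Nat.cast_le.2 (Finset.mem_Icc.1 hi).2
      nlinarith
  by_cases hf0 : f =ᵐ[volume] 0
  · refine (concaveOn_const 0 (convex_Ioi _)).congr fun p hp ↦ ?_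
    have hp0 : p ≠ 0 := (max_lt_iff.1 (Set.mem_Ioi.1 hp)).1.ne'
    have hzero : ∫ x, f x ^ p = 0 := integral_eq_zero_of_ae <| by
      filter_upwards [hf0] with x hx
      simp [hx, zero_rpow hp0]
    simp [hzero]
  · refine ((hf_sconc.ennLogConcaveOn_prod_mul_lintegral_rpow hf_nonneg).concaveOn_log_toReal
      fun p hp ↦ ?_).congr fun p hp ↦ ?_
    · refine mul_ne_zero (ENNReal.ofReal_pos.2 (hprod p hp)).ne' fun h ↦ hf0 ?_
      rw [lintegral_eq_zero_iff' (hf_int.aemeasurable.pow_const p).ennreal_ofReal] at h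
      filter_upwards [h] with x hx
      by_contra hfx
      exact (ENNReal.ofReal_pos.2
        (rpow_pos_of_pos ((hf_nonneg x).lt_of_ne' hfx) p)).ne' hx
    · simp only [hinteg, ENNReal.toReal_mul, ENNReal.toReal_ofReal (hprod p hp).le]
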